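/- Let K ⊂ ℝ² be a convex body with C² boundary and minimal curvature κ_m, and let r > 1/κ_m. Then Per(K) + Per(K^{*,r}) = 2πr, where Per denotes perimeter. -/

import Mathlib

open Metric MeasureTheory
open Set Filter Topology
open scoped ENNReal NNReal RealInnerProductSpace

theorem ofReal_dist_le_hausdorffMeasure_image_Ico {X : Type*} [MetricSpace X] [MeasurableSpace X]
    [BorelSpace X] {c : ℝ → X} {s t : ℝ} (hst : s ≤ t)
    (hc : ContinuousOn c (Icc s t)) :
    ENNReal.ofReal (dist (c t) (c s)) ≤ μH[1] (c '' Ico s t) := by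
  have hsub : Ico 0 (dist (c t) (c s)) ⊆ (fun x => dist x (c s)) '' (c '' Ico s t) := by
    rw [image_image]
    simpa using intermediate_value_Ico hst (f := fun x => dist (c x) (c s))
      (continuous_id.dist continuous_const |>.comp_continuousOn hc)
  calc ENNReal.ofReal (dist (c t) (c s))
      = μH[1] (Ico 0 (dist (c t) (c s))) := by simp [hausdorffMeasure_real]
    _ ≤ μH[1] ((fun x => dist x (c s)) '' (c '' Ico s t)) := measure_mono hsub
    _ ≤ μH[1] (c '' Ico s t) := by
      simpa using (LipschitzWith.dist_left (c s)).hausdorffMeasure_image_le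
        zero_le_one (c '' Ico s t)

section Curves

variable {E : Type*} [NormedAddCommGroup E] [NormedSpace ℝ E] [MeasurableSpace E] [BorelSpace E]

theorem hausdorffMeasure_image_Ico_le_of_norm_deriv_le {c c' : ℝ → E} {s t C : ℝ} (hC : 0 ≤ C)
    (hc : ∀ x, HasDerivAt c (c' x) x) (hbound : ∀ x ∈ Icc s t, ‖c' x‖ ≤ C) :
    μH[1] (c '' Ico s t) ≤ ENNReal.ofReal (C * (t - s)) := by
  have hlip : LipschitzOnWith C.toNNReal c (Ico s t) :=
    (convex_Ico s t).lipschitzOnWith_of_nnnorm_hasDerivWithin_le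
      (fun x _ => (hc x).hasDerivWithinAt) fun x hx => by
        rw [← NNReal.coe_le_coe, coe_nnnorm, Real.coe_toNNReal C hC]
        exact hbound x (Ico_subset_Icc_self hx)
  have h := hlip.hausdorffMeasure_image_le zero_le_one
  rw [hausdorffMeasure_real, Real.volume_Ico, ENNReal.rpow_one] at h
  rwa [ENNReal.ofReal_mul hC]

/-- The length of an injective `C¹` curve is the integral of its speed. -/
theorem hausdorffMeasure_image_Ico_eq_integral {c c' : ℝ → E} {a b : ℝ} (hab : a ≤ b)
    (hc : ∀ x, HasDerivAt c (c' x) x) (hc' : Continuous c') (hinj : InjOn c (Ico a b)) :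
    (μH[1] (c '' Ico a b)).toReal = ∫ x in a..b, ‖c' x‖ := by
  have hcont : Continuous c := continuous_iff_continuousAt.2 fun x => (hc x).continuousAt
  have hfin : ∀ s t, μH[1] (c '' Ico s t) ≠ ∞ := fun s t => by
    obtain ⟨C, hC⟩ := isCompact_Icc.exists_bound_of_continuousOn (s := Icc s t) hc'.continuousOn
    exact ((hausdorffMeasure_image_Ico_le_of_norm_deriv_le (le_max_right C 0) hc
      fun x hx => (hC x hx).trans (le_max_left C 0)).trans_lt ENNReal.ofReal_lt_top).ne
  have hadd : ∀ s ∈ Icc a b, ∀ t ∈ Icc a b, s ≤ t →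
      (μH[1] (c '' Ico a t)).toReal - (μH[1] (c '' Ico a s)).toReal
        = (μH[1] (c '' Ico s t)).toReal := by
    intro s hs t ht hst
    have hdisj : Disjoint (c '' Ico a s) (c '' Ico s t) :=
      Disjoint.image (disjoint_left.2 fun x hx hx' => hx.2.not_ge hx'.1) hinj
        (Ico_subset_Ico_right hs.2) (Ico_subset_Ico hs.1 ht.2)
    have hmeas : MeasurableSet (c '' Ico s t) :=
      measurableSet_Ico.image_of_continuousOn_injOn hcont.continuousOn
        (hinj.mono (Ico_subset_Ico hs.1 ht.2))
    rw [← Ico_union_Ico_eq_Ico hs.1 hst, image_union, measure_union hdisj hmeas,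
      ENNReal.toReal_add (hfin _ _) (hfin _ _)]
    ring
  have hup : ∀ s t C, s ≤ t → 0 ≤ C → (∀ x ∈ Icc s t, ‖c' x‖ ≤ C) →
      (μH[1] (c '' Ico s t)).toReal ≤ C * (t - s) := fun s t C hst hC h =>
    ENNReal.toReal_le_of_le_ofReal (mul_nonneg hC (sub_nonneg.2 hst))
      (hausdorffMeasure_image_Ico_le_of_norm_deriv_le hC hc h)
  have hlow : ∀ s t, s ≤ t → ‖c t - c s‖ ≤ (μH[1] (c '' Ico s t)).toReal := fun s t hst => by
    rw [← dist_eq_norm]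
    exact (ENNReal.ofReal_le_iff_le_toReal (hfin _ _)).1
      (ofReal_dist_le_hausdorffMeasure_image_Ico hst hcont.continuousOn)
  have key := intervalIntegral.integral_eq_sub_of_hasDeriv_right_of_le hab
    (f := fun t => (μH[1] (c '' Ico a t)).toReal) (f' := fun x => ‖c' x‖) ?_ ?_
    (hc'.norm.intervalIntegrable a b)
  · simpa using key.symm
  · obtain ⟨C, hC⟩ := isCompact_Icc.exists_bound_of_continuousOn (s := Icc a b) hc'.continuousOn
    have hC0 : 0 ≤ C := (norm_nonneg _).trans (hC a (left_mem_Icc.2 hab))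
    refine (LipschitzOnWith.of_le_add_mul' C fun s hs t ht => ?_).continuousOn
    rcases le_total s t with hst | hst
    · have h1 := hadd s hs t ht hst
      have h2 : 0 ≤ (μH[1] (c '' Ico s t)).toReal := ENNReal.toReal_nonneg
      have h3 : 0 ≤ C * dist s t := mul_nonneg hC0 dist_nonneg
      linarith
    · have h1 := hadd t ht s hs hst
      have h2 := hup t s C hst hC0 fun x hx => hC x (Icc_subset_Icc ht.1 hs.2 hx)
      rw [Real.dist_eq, abs_of_nonneg (sub_nonneg.2 hst)]
      linarith
  · intro s hs
    have hs' : s ∈ Icc a b := Ioo_subset_Icc_self hs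
    rw [hasDerivWithinAt_iff_tendsto_slope' self_notMem_Ioi]
    have hnear : ∀ᶠ t in 𝓝[>] s, t ∈ Ioo s b := Ioo_mem_nhdsGT hs.2
    refine tendsto_order.2 ⟨fun m hm => ?_, fun M hM => ?_⟩
    · have hslope := ((hasDerivWithinAt_iff_tendsto_slope' self_notMem_Ioi).1
        ((hc s).hasDerivWithinAt (s := Ioi s))).norm
      filter_upwards [hslope.eventually (lt_mem_nhds hm), hnear] with t ht htb
      refine ht.trans_le ?_
      rw [slope_def_module, slope_def_field, hadd s hs' t ⟨hs'.1.trans htb.1.le, htb.2.le⟩ htb.1.le,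
        norm_smul, norm_inv, Real.norm_of_nonneg (sub_nonneg.2 htb.1.le), div_eq_inv_mul]
      exact mul_le_mul_of_nonneg_left (hlow s t htb.1.le) (inv_nonneg.2 (sub_nonneg.2 htb.1.le))
    · obtain ⟨M', hM', hM'M⟩ := exists_between hM
      obtain ⟨u, hu, hu'⟩ := mem_nhdsGE_iff_exists_Ico_subset.1
        ((hc'.norm.continuousAt.eventually (gt_mem_nhds hM')).filter_mono
          (nhdsWithin_le_nhds (s := Ici s)))
      filter_upwards [hnear, Ioo_mem_nhdsGT hu] with t htb htu
      refine lt_of_le_of_lt ?_ hM'M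
      rw [slope_def_field, hadd s hs' t ⟨hs'.1.trans htb.1.le, htb.2.le⟩ htb.1.le,
        div_le_iff₀ (sub_pos.2 htb.1)]
      exact hup s t M' htb.1.le ((norm_nonneg _).trans hM'.le)
        fun x hx => le_of_lt (hu' ⟨hx.1, hx.2.trans_lt htu.2⟩)

end Curves

/-- The unit vector in the plane at angle `θ`. -/
noncomputable def unitVec (θ : ℝ) : EuclideanSpace ℝ (Fin 2) := !₂[Real.cos θ, Real.sin θ]

/-- The unit vector at angle `θ`, rotated by a right angle. -/
noncomputable def unitNormal (θ : ℝ) : EuclideanSpace ℝ (Fin 2) := !₂[-Real.sin θ, Real.cos θ]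

theorem inner_plane (x y : EuclideanSpace ℝ (Fin 2)) : ⟪x, y⟫ = x 0 * y 0 + x 1 * y 1 := by
  simp [PiLp.inner_apply, mul_comm]

theorem norm_unitVec (θ : ℝ) : ‖unitVec θ‖ = 1 := by
  simp [unitVec, EuclideanSpace.norm_eq]

theorem norm_unitNormal (θ : ℝ) : ‖unitNormal θ‖ = 1 := by
  simp [unitNormal, EuclideanSpace.norm_eq]

theorem inner_unitVec_unitNormal (τ φ : ℝ) : ⟪unitVec τ, unitNormal φ⟫ = Real.sin (τ - φ) := by
  rw [inner_plane, Real.sin_sub]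
  simp [unitVec, unitNormal]
  ring

theorem hasDerivAt_plane {f : ℝ → EuclideanSpace ℝ (Fin 2)} {f' : EuclideanSpace ℝ (Fin 2)}
    {x : ℝ} : HasDerivAt f f' x ↔ ∀ i, HasDerivAt (fun t => f t i) (f' i) x := by
  rw [hasDerivAt_iff_hasFDerivAt, ← hasFDerivWithinAt_univ, hasFDerivWithinAt_euclidean]
  refine forall_congr' fun i => ?_
  have h : (PiLp.proj 2 (fun _ : Fin 2 => ℝ) i) ∘L ContinuousLinearMap.toSpanSingleton ℝ f' =
      ContinuousLinearMap.toSpanSingleton ℝ (f' i) := by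
    ext
    simp
  rw [hasFDerivWithinAt_univ, hasDerivAt_iff_hasFDerivAt, h]

theorem hasDerivAt_unitNormal (θ : ℝ) : HasDerivAt unitNormal (-unitVec θ) θ := by
  refine hasDerivAt_plane.2 fun i => ?_
  fin_cases i
  · exact (Real.hasDerivAt_sin θ).neg
  · exact Real.hasDerivAt_cos θ

theorem continuous_unitVec : Continuous unitVec := by
  unfold unitVec
  fun_prop

theorem exists_unitVec_eq {x : EuclideanSpace ℝ (Fin 2)} (hx : ‖x‖ = 1) :
    ∃ θ, x = unitVec θ := by
  have h : ‖(⟨x 0, x 1⟩ : ℂ)‖ = 1 := by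
    rw [EuclideanSpace.norm_eq] at hx
    simpa [Complex.norm_def, Complex.normSq_apply, ← sq] using hx
  refine ⟨Complex.arg ⟨x 0, x 1⟩, ?_⟩
  have h0 := Complex.norm_mul_cos_arg ⟨x 0, x 1⟩
  have h1 := Complex.norm_mul_sin_arg ⟨x 0, x 1⟩
  rw [h, one_mul] at h0 h1
  ext i
  fin_cases i
  · simpa [unitVec] using h0.symm
  · simpa [unitVec] using h1.symm

theorem unitNormal_eq_unitVec (θ : ℝ) : unitNormal θ = unitVec (θ + Real.pi / 2) := by
  simp [unitNormal, unitVec, Real.cos_add_pi_div_two, Real.sin_add_pi_div_two]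

theorem exists_unitNormal_eq {x : EuclideanSpace ℝ (Fin 2)} (hx : ‖x‖ = 1) :
    ∃ θ, x = unitNormal θ := by
  obtain ⟨θ, hθ⟩ := exists_unitVec_eq hx
  exact ⟨θ - Real.pi / 2, by rw [hθ, unitNormal_eq_unitVec, sub_add_cancel]⟩

theorem exists_int_of_unitNormal_eq {θ φ : ℝ} (h : unitNormal θ = unitNormal φ) :
    ∃ k : ℤ, θ - φ = 2 * Real.pi * k := by
  have h0 : -Real.sin θ = -Real.sin φ := congrArg (fun x : EuclideanSpace ℝ (Fin 2) => x 0) h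
  have h1 : Real.cos θ = Real.cos φ := congrArg (fun x : EuclideanSpace ℝ (Fin 2) => x 1) h
  exact Real.Angle.angle_eq_iff_two_pi_dvd_sub.1 (Real.Angle.cos_sin_inj h1 (neg_inj.1 h0))

theorem hasDerivAt_inner_unitNormal {q : ℝ → EuclideanSpace ℝ (Fin 2)} {w τ : ℝ}
    (hq : HasDerivAt q (w • unitVec τ) τ) (φ : ℝ) :
    HasDerivAt (fun t => ⟪q t, unitNormal φ⟫) (w * Real.sin (τ - φ)) τ := by
  have h := hq.inner ℝ (hasDerivAt_const τ (unitNormal φ))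
  rwa [inner_zero_right, zero_add, real_inner_smul_left, inner_unitVec_unitNormal] at h

/-- A unit speed curve of curvature bounded below by `κm > 0` can be parametrized by the angle of
its tangent. -/
theorem exists_tangent_angle_parametrization {γ : ℝ → EuclideanSpace ℝ (Fin 2)}
    (hγ : ContDiff ℝ 2 γ) (hγspeed : ∀ s, ‖deriv γ s‖ = 1) {κ : ℝ → ℝ}
    (hκdef : ∀ s, κ s =
      deriv γ s 0 * deriv (deriv γ) s 1 - deriv γ s 1 * deriv (deriv γ) s 0)
    {κm : ℝ} (hκm : 0 < κm) (hκ : ∀ s, κm ≤ κ s) :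
    ∃ (c : ℝ → EuclideanSpace ℝ (Fin 2)) (ρ : ℝ → ℝ), Continuous ρ ∧ (∀ θ, 0 < ρ θ) ∧
      (∀ θ, ρ θ ≤ 1 / κm) ∧ (∀ θ, HasDerivAt c (ρ θ • unitVec θ) θ) ∧ range c = range γ := by
  have hT : ContDiff ℝ 1 (deriv γ) := by
    have : ContDiff ℝ (1 + 1) γ := by convert hγ using 1; norm_num
    exact (contDiff_succ_iff_deriv.1 this).2.2
  have hT' : Continuous (deriv (deriv γ)) := hT.continuous_deriv le_rfl
  have hTd : ∀ s i, HasDerivAt (fun t => deriv γ t i) (deriv (deriv γ) s i) s := fun s =>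
    hasDerivAt_plane.1 (hT.differentiable one_ne_zero s).hasDerivAt
  have hsq : ∀ s, deriv γ s 0 ^ 2 + deriv γ s 1 ^ 2 = 1 := fun s => by
    have := EuclideanSpace.real_norm_sq_eq (deriv γ s)
    rw [hγspeed, Fin.sum_univ_two] at this
    linarith
  have horth : ∀ s, deriv γ s 0 * deriv (deriv γ) s 0 + deriv γ s 1 * deriv (deriv γ) s 1 = 0 :=
    fun s => by
      have h := ((hTd s 0).pow 2).add ((hTd s 1).pow 2)
      have h1 := h.unique ((hasDerivAt_const s (1 : ℝ)).congr_of_eventuallyEq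
        (Eventually.of_forall hsq))
      simp at h1
      linarith
  have hd0 : ∀ s, deriv (deriv γ) s 0 = -κ s * deriv γ s 1 := fun s => by
    rw [hκdef]
    linear_combination (-deriv (deriv γ) s 0) * hsq s + deriv γ s 0 * horth s
  have hd1 : ∀ s, deriv (deriv γ) s 1 = κ s * deriv γ s 0 := fun s => by
    rw [hκdef]
    linear_combination (-deriv (deriv γ) s 1) * hsq s + deriv γ s 1 * horth s
  have hκc : Continuous κ := by
    rw [funext hκdef]
    have := hT.continuous
    fun_prop
  obtain ⟨φ₀, hφ₀⟩ := exists_unitVec_eq (hγspeed 0)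
  let φ : ℝ → ℝ := fun s => φ₀ + ∫ t in (0 : ℝ)..s, κ t
  have hφ : ∀ s, HasDerivAt φ (κ s) s := fun s =>
    (intervalIntegral.integral_hasDerivAt_right (hκc.intervalIntegrable _ _)
      (hκc.stronglyMeasurableAtFilter _ _) hκc.continuousAt).const_add φ₀
  have hTφ : ∀ s, deriv γ s = unitVec (φ s) := by
    intro s
    have hder : ∀ s, HasDerivAt (fun t => deriv γ t 0 * Real.cos (φ t)
        + deriv γ t 1 * Real.sin (φ t)) 0 s := fun s => by
      refine (((hTd s 0).mul (hφ s).cos).add ((hTd s 1).mul (hφ s).sin)).congr_deriv ?_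
      rw [hd0, hd1]
      ring
    have hconst := is_const_of_deriv_eq_zero (fun s => (hder s).differentiableAt)
      (fun s => (hder s).deriv) s 0
    have h1 : deriv γ s 0 * Real.cos (φ s) + deriv γ s 1 * Real.sin (φ s) = 1 := by
      rw [hconst, hφ₀]
      simp [φ, unitVec, ← sq]
    have h2 := hsq s
    have h3 := Real.sin_sq_add_cos_sq (φ s)
    have h4 : (deriv γ s 0 - Real.cos (φ s)) ^ 2 + (deriv γ s 1 - Real.sin (φ s)) ^ 2 = 0 := by
      nlinarith
    obtain ⟨h5, h6⟩ := (add_eq_zero_iff_of_nonneg (sq_nonneg _) (sq_nonneg _)).1 h4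
    ext i
    fin_cases i
    · simpa [unitVec] using sub_eq_zero.1 (sq_eq_zero_iff.1 h5)
    · simpa [unitVec] using sub_eq_zero.1 (sq_eq_zero_iff.1 h6)
  have hφc : Continuous φ := continuous_iff_continuousAt.2 fun s => (hφ s).continuousAt
  have hmono : StrictMono φ := strictMono_of_deriv_pos fun s => by
    rw [(hφ s).deriv]
    exact hκm.trans_le (hκ s)
  have hlin : Monotone fun s => φ s - κm * s := by
    have h : ∀ s, HasDerivAt (fun s => φ s - κm * s) (κ s - κm) s := fun s => by
      refine ((hφ s).sub ((hasDerivAt_id s).const_mul κm)).congr_deriv ?_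
      rw [mul_one]
    exact monotone_of_deriv_nonneg (fun s => (h s).differentiableAt) fun s => by
      rw [(h s).deriv]
      exact sub_nonneg.2 (hκ s)
  have htop : Tendsto φ atTop atTop := by
    refine tendsto_atTop_mono' _ ?_ (tendsto_atTop_add_const_right _ (φ 0)
      (tendsto_id.const_mul_atTop hκm))
    filter_upwards [eventually_ge_atTop 0] with s hs
    have := hlin hs
    simp at this ⊢
    linarith
  have hbot : Tendsto φ atBot atBot := by
    refine tendsto_atBot_mono' _ ?_ (tendsto_atBot_add_const_right _ (φ 0)
      (tendsto_id.const_mul_atBot hκm))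
    filter_upwards [eventually_le_atBot 0] with s hs
    have := hlin hs
    simp at this ⊢
    linarith
  let Φ : ℝ ≃o ℝ := hmono.orderIsoOfSurjective φ (hφc.surjective htop hbot)
  have hΦ : ∀ θ, φ (Φ.symm θ) = θ := Φ.apply_symm_apply
  have hpos : ∀ s, 0 < κ s := fun s => hκm.trans_le (hκ s)
  refine ⟨γ ∘ Φ.symm, fun θ => (κ (Φ.symm θ))⁻¹,
    (hκc.comp Φ.symm.continuous).inv₀ fun θ => (hpos _).ne', fun θ => inv_pos.2 (hpos _),
    fun θ => ?_, fun θ => ?_, ?_⟩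
  · rw [one_div]
    exact inv_anti₀ hκm (hκ _)
  · have h := HasDerivAt.of_local_left_inverse Φ.symm.continuous.continuousAt (hφ (Φ.symm θ))
      (hpos _).ne' (Eventually.of_forall hΦ)
    have h' := HasDerivAt.scomp θ (hγ.differentiable two_ne_zero (Φ.symm θ)).hasDerivAt h
    rwa [hTφ, hΦ] at h'
  · exact Φ.symm.surjective.range_comp γ

theorem inner_lt_inner_of_abs_sub_le_pi {q : ℝ → EuclideanSpace ℝ (Fin 2)} {w : ℝ → ℝ}
    (hw : ∀ θ, 0 < w θ) (hq : ∀ θ, HasDerivAt q (w θ • unitVec θ) θ) {θ φ : ℝ} (hne : θ ≠ φ)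
    (hle : |θ - φ| ≤ Real.pi) : ⟪q φ, unitNormal φ⟫ < ⟪q θ, unitNormal φ⟫ := by
  have hder := fun t => hasDerivAt_inner_unitNormal (hq t) φ
  have hcont : Continuous fun t => ⟪q t, unitNormal φ⟫ :=
    continuous_iff_continuousAt.2 fun t => (hder t).continuousAt
  rw [abs_le] at hle
  rcases hne.lt_or_gt with h | h
  · refine strictAntiOn_of_deriv_neg (convex_Icc (φ - Real.pi) φ) hcont.continuousOn
      (fun t ht => ?_) ⟨by linarith, h.le⟩ ⟨by linarith, le_rfl⟩ h
    rw [interior_Icc] at ht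
    rw [(hder t).deriv]
    exact mul_neg_of_pos_of_neg (hw t)
      (Real.sin_neg_of_neg_of_neg_pi_lt (by linarith [ht.2]) (by linarith [ht.1]))
  · refine strictMonoOn_of_deriv_pos (convex_Icc φ (φ + Real.pi)) hcont.continuousOn
      (fun t ht => ?_) ⟨le_rfl, by linarith⟩ ⟨h.le, by linarith⟩ h
    rw [interior_Icc] at ht
    rw [(hder t).deriv]
    exact mul_pos (hw t) (Real.sin_pos_of_pos_of_lt_pi (by linarith [ht.1]) (by linarith [ht.2]))

theorem periodic_unitNormal : Function.Periodic unitNormal (2 * Real.pi) := fun θ => by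
  simp [unitNormal]

theorem hasDerivAt_neg_add_smul_unitNormal {c : ℝ → EuclideanSpace ℝ (Fin 2)} {w θ : ℝ}
    (hc : HasDerivAt c (w • unitVec θ) θ) (r : ℝ) :
    HasDerivAt (fun θ => -(c θ + r • unitNormal θ)) ((r - w) • unitVec θ) θ :=
  (hc.add ((hasDerivAt_unitNormal θ).const_smul r)).neg.congr_deriv (by module)

theorem periodic_neg_add_smul_unitNormal {c : ℝ → EuclideanSpace ℝ (Fin 2)}
    (hc : Function.Periodic c (2 * Real.pi)) (r : ℝ) :
    Function.Periodic (fun θ => -(c θ + r • unitNormal θ)) (2 * Real.pi) :=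
  fun θ => by simp only [hc θ, periodic_unitNormal θ]

theorem unitNormal_add_pi (θ : ℝ) : unitNormal (θ + Real.pi) = -unitNormal θ := by
  ext i
  fin_cases i <;> simp [unitNormal]

theorem eq_or_inner_lt_inner_of_periodic {q : ℝ → EuclideanSpace ℝ (Fin 2)} {w : ℝ → ℝ}
    (hw : ∀ θ, 0 < w θ) (hq : ∀ θ, HasDerivAt q (w θ • unitVec θ) θ)
    (hper : Function.Periodic q (2 * Real.pi)) (θ φ : ℝ) :
    (unitNormal θ = unitNormal φ ∧ q θ = q φ) ∨ ⟪q φ, unitNormal φ⟫ < ⟪q θ, unitNormal φ⟫ := by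
  obtain ⟨h1, h2⟩ := toIocMod_mem_Ioc Real.two_pi_pos (φ - Real.pi) θ
  have hθ := toIocMod_add_toIocDiv_zsmul Real.two_pi_pos (φ - Real.pi) θ
  set θ' := toIocMod Real.two_pi_pos (φ - Real.pi) θ
  rw [← hθ, periodic_unitNormal.zsmul _ _, hper.zsmul _ _]
  by_cases h : θ' = φ
  · exact Or.inl (by rw [h]; exact ⟨rfl, rfl⟩)
  · exact Or.inr (inner_lt_inner_of_abs_sub_le_pi hw hq h (abs_le.2 ⟨by linarith, by linarith⟩))

theorem inner_le_inner_of_periodic {q : ℝ → EuclideanSpace ℝ (Fin 2)} {w : ℝ → ℝ}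
    (hw : ∀ θ, 0 < w θ) (hq : ∀ θ, HasDerivAt q (w θ • unitVec θ) θ)
    (hper : Function.Periodic q (2 * Real.pi)) (θ φ : ℝ) :
    ⟪q φ, unitNormal φ⟫ ≤ ⟪q θ, unitNormal φ⟫ := by
  rcases eq_or_inner_lt_inner_of_periodic hw hq hper θ φ with h | h
  · rw [h.2]
  · exact h.le

theorem injOn_Ico_of_periodic {q : ℝ → EuclideanSpace ℝ (Fin 2)} {w : ℝ → ℝ}
    (hw : ∀ θ, 0 < w θ) (hq : ∀ θ, HasDerivAt q (w θ • unitVec θ) θ)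
    (hper : Function.Periodic q (2 * Real.pi)) : InjOn q (Ico 0 (2 * Real.pi)) := by
  intro θ hθ φ hφ h
  rcases eq_or_inner_lt_inner_of_periodic hw hq hper θ φ with ⟨hn, -⟩ | hlt
  · obtain ⟨k, hk⟩ := exists_int_of_unitNormal_eq hn
    have hpi := Real.two_pi_pos
    have h1 : (k : ℝ) < 1 := by
      by_contra! h1
      nlinarith [hθ.2, hφ.1]
    have h2 : (-1 : ℝ) < k := by
      by_contra! h2
      nlinarith [hφ.2, hθ.1]
    have h1' : k < 1 := by exact_mod_cast h1
    have h2' : -1 < k := by exact_mod_cast h2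
    obtain rfl : k = 0 := by omega
    simpa [sub_eq_zero] using hk
  · rw [h] at hlt
    exact absurd hlt (lt_irrefl _)

/-- The only direction in which a curve with tangent `unitVec φ` at `q φ` can be supported at `q φ`
is `unitNormal φ`. -/
theorem unitNormal_eq_of_forall_inner_le {q : ℝ → EuclideanSpace ℝ (Fin 2)} {w : ℝ → ℝ}
    (hw : ∀ θ, 0 < w θ) (hq : ∀ θ, HasDerivAt q (w θ • unitVec θ) θ) {φ ψ : ℝ}
    (h : ∀ t, ⟪q φ, unitNormal ψ⟫ ≤ ⟪q t, unitNormal ψ⟫) : unitNormal φ = unitNormal ψ := by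
  have hmin : IsLocalMin (fun t => ⟪q t, unitNormal ψ⟫) φ := Eventually.of_forall h
  have hsin := hmin.hasDerivAt_eq_zero (hasDerivAt_inner_unitNormal (hq φ) ψ)
  obtain ⟨k, hk⟩ := Real.sin_eq_zero_iff.1 ((mul_eq_zero.1 hsin).resolve_left (hw φ).ne')
  obtain ⟨j, rfl | rfl⟩ := k.even_or_odd'
  · have : φ = ψ + j • (2 * Real.pi) := by
      push_cast at hk
      rw [zsmul_eq_mul]
      linarith
    rw [this, periodic_unitNormal.zsmul]
  · have : ψ + Real.pi = φ + (-j) • (2 * Real.pi) := by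
      push_cast at hk
      rw [zsmul_eq_mul]
      push_cast
      linarith
    have hψ : unitNormal ψ = -unitNormal φ := by
      rw [← neg_eq_iff_eq_neg, ← unitNormal_add_pi, this, periodic_unitNormal.zsmul]
    have h1 := h (φ + Real.pi)
    rw [hψ, inner_neg_right, inner_neg_right, neg_le_neg_iff] at h1
    exact absurd (inner_lt_inner_of_abs_sub_le_pi hw hq (θ := φ + Real.pi) (φ := φ)
      (by simp [Real.pi_ne_zero]) (by simp [abs_of_pos Real.pi_pos])) h1.not_gt

section Support

variable {E : Type*} [NormedAddCommGroup E] [InnerProductSpace ℝ E]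

theorem notMem_interior_of_forall_inner_le {K : Set E} {x v : E} (hv : v ≠ 0)
    (h : ∀ y ∈ K, ⟪x, v⟫ ≤ ⟪y, v⟫) : x ∉ interior K := by
  intro hx
  have htend : Tendsto (fun t : ℝ => x - t • v) (𝓝[>] 0) (𝓝 x) := by
    have : Continuous fun t : ℝ => x - t • v := by fun_prop
    simpa using (this.tendsto 0).mono_left nhdsWithin_le_nhds
  obtain ⟨t, htK, ht⟩ := ((htend.eventually (mem_interior_iff_mem_nhds.1 hx)).and
    self_mem_nhdsWithin).exists
  have h1 := h _ htK
  rw [inner_sub_left, real_inner_smul_left] at h1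
  have h2 : 0 < t * ⟪v, v⟫ := mul_pos ht (real_inner_self_pos.2 hv)
  linarith

theorem Convex.exists_forall_inner_le_of_notMem_interior [CompleteSpace E] {K : Set E}
    (hK : Convex ℝ K) (hint : (interior K).Nonempty) {x : E} (hx : x ∉ interior K) :
    ∃ v : E, ‖v‖ = 1 ∧ ∀ y ∈ K, ⟪x, v⟫ ≤ ⟪y, v⟫ := by
  obtain ⟨f, hf⟩ := geometric_hahn_banach_open_point hK.interior isOpen_interior hx
  set v := -(InnerProductSpace.toDual ℝ E).symm f
  have hv : ∀ y, ⟪y, v⟫ = -f y := fun y => by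
    rw [real_inner_comm, inner_neg_left, InnerProductSpace.toDual_symm_apply]
  have hv0 : v ≠ 0 := by
    intro h0
    obtain ⟨z, hz⟩ := hint
    have h1 := hf z hz
    have h2 := hv z
    have h3 := hv x
    rw [h0, inner_zero_right] at h2 h3
    linarith
  have hle : ∀ y ∈ K, f y ≤ f x := fun y hy => by
    have hy' : y ∈ closure (interior K) := by
      rw [hK.closure_interior_eq_closure_of_nonempty_interior hint]
      exact subset_closure hy
    exact closure_minimal (fun z hz => (hf z hz).le)
      (isClosed_le f.continuous continuous_const) hy'
  refine ⟨‖v‖⁻¹ • v, by simp [norm_smul, hv0], fun y hy => ?_⟩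
  rw [real_inner_smul_right, real_inner_smul_right, hv, hv]
  exact mul_le_mul_of_nonneg_left (neg_le_neg (hle y hy)) (inv_nonneg.2 (norm_nonneg v))

end Support

section Boundary

variable {K : Set (EuclideanSpace ℝ (Fin 2))} {c : ℝ → EuclideanSpace ℝ (Fin 2)} {ρ : ℝ → ℝ}

theorem inner_le_inner_of_frontier_eq_range (hKc : IsClosed K) (hKconv : Convex ℝ K)
    (hKint : (interior K).Nonempty) (hρ : ∀ θ, 0 < ρ θ)
    (hc : ∀ θ, HasDerivAt c (ρ θ • unitVec θ) θ) (hrange : frontier K = range c)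
    {y : EuclideanSpace ℝ (Fin 2)} (hy : y ∈ K) (φ : ℝ) :
    ⟪c φ, unitNormal φ⟫ ≤ ⟪y, unitNormal φ⟫ := by
  have hmem : ∀ θ, c θ ∈ frontier K := fun θ => hrange ▸ mem_range_self θ
  obtain ⟨v, hv1, hv⟩ := hKconv.exists_forall_inner_le_of_notMem_interior hKint (hmem φ).2
  obtain ⟨ψ, rfl⟩ := exists_unitNormal_eq hv1
  rw [unitNormal_eq_of_forall_inner_le hρ hc fun t => hv _ (hKc.frontier_subset (hmem t))]
  exact hv y hy

/-- The supporting lines of `K` touch it in one point only. -/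
theorem eq_of_inner_le_of_frontier_eq_range (hKc : IsClosed K) (hKconv : Convex ℝ K)
    (hKint : (interior K).Nonempty) (hρ : ∀ θ, 0 < ρ θ)
    (hc : ∀ θ, HasDerivAt c (ρ θ • unitVec θ) θ) (hrange : frontier K = range c)
    {y : EuclideanSpace ℝ (Fin 2)} (hy : y ∈ K) {φ : ℝ}
    (hle : ⟪y, unitNormal φ⟫ ≤ ⟪c φ, unitNormal φ⟫) : y = c φ := by
  have hmem : ∀ θ, c θ ∈ K := fun θ => hKc.frontier_subset (hrange ▸ mem_range_self θ)
  have hsupp := fun (z) (hz : z ∈ K) (θ) =>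
    inner_le_inner_of_frontier_eq_range hKc hKconv hKint hρ hc hrange hz θ
  let F := K ∩ {z | ⟪z, unitNormal φ⟫ ≤ ⟪c φ, unitNormal φ⟫}
  have hFconv : Convex ℝ F := hKconv.inter
    (convex_halfSpace_le (f := fun z => ⟪z, unitNormal φ⟫)
      ⟨fun _ _ => inner_add_left _ _ _, fun _ _ => real_inner_smul_left _ _ _⟩ _)
  have hFcount : F.Countable := by
    refine (countable_range fun k : ℤ => c (φ + 2 * Real.pi * k)).mono fun z hz => ?_
    have hz' : ∀ x ∈ K, ⟪z, unitNormal φ⟫ ≤ ⟪x, unitNormal φ⟫ := fun x hx =>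
      (show _ ≤ _ from hz.2).trans (hsupp x hx φ)
    have hzf : z ∈ range c := by
      rw [← hrange]
      refine ⟨subset_closure hz.1, notMem_interior_of_forall_inner_le ?_ hz'⟩
      exact norm_ne_zero_iff.1 (by simp [norm_unitNormal])
    obtain ⟨τ, rfl⟩ := hzf
    obtain ⟨k, hk⟩ := exists_int_of_unitNormal_eq
      (unitNormal_eq_of_forall_inner_le hρ hc fun t => hz' _ (hmem t))
    exact ⟨k, by simp only [← hk, add_sub_cancel]⟩
  exact hFcount.isTotallyDisconnected F subset_rfl hFconv.isPreconnected ⟨hy, hle⟩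
    ⟨hmem φ, le_refl ⟪c φ, unitNormal φ⟫⟩

theorem periodic_of_frontier_eq_range (hKc : IsClosed K) (hKconv : Convex ℝ K)
    (hKint : (interior K).Nonempty) (hρ : ∀ θ, 0 < ρ θ)
    (hc : ∀ θ, HasDerivAt c (ρ θ • unitVec θ) θ) (hrange : frontier K = range c) :
    Function.Periodic c (2 * Real.pi) := fun θ => by
  have hmem : ∀ θ, c θ ∈ K := fun θ => hKc.frontier_subset (hrange ▸ mem_range_self θ)
  refine eq_of_inner_le_of_frontier_eq_range hKc hKconv hKint hρ hc hrange (hmem _) ?_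
  have := inner_le_inner_of_frontier_eq_range hKc hKconv hKint hρ hc hrange (hmem θ)
    (θ + 2 * Real.pi)
  rwa [periodic_unitNormal θ] at this

/-- The boundary of the `r`-dual of `K` is the inner parallel curve at distance `r`. -/
theorem frontier_setOf_subset_closedBall (hKcomp : IsCompact K) (hKconv : Convex ℝ K)
    (hKint : (interior K).Nonempty) (hρ : ∀ θ, 0 < ρ θ)
    (hc : ∀ θ, HasDerivAt c (ρ θ • unitVec θ) θ) (hrange : frontier K = range c)
    {r : ℝ} (hr : ∀ θ, ρ θ < r) :
    frontier {x | K ⊆ closedBall x r} = range fun θ => c θ + r • unitNormal θ := by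
  have hKc := hKcomp.isClosed
  have hr0 : 0 < r := (hρ 0).trans (hr 0)
  have hmem : ∀ θ, c θ ∈ K := fun θ => hKc.frontier_subset (hrange ▸ mem_range_self θ)
  have hper := periodic_of_frontier_eq_range hKc hKconv hKint hρ hc hrange
  have hnn : ∀ θ, ⟪unitNormal θ, unitNormal θ⟫ = 1 := fun θ => by
    rw [real_inner_self_eq_norm_sq, norm_unitNormal, one_pow]
  have hd := fun θ => hasDerivAt_neg_add_smul_unitNormal (hc θ) r
  have hdper := periodic_neg_add_smul_unitNormal hper r
  have hclosed : IsClosed {x | K ⊆ closedBall x r} := by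
    have : {x | K ⊆ closedBall x r} = ⋂ y ∈ K, closedBall y r := by
      ext x
      simp [subset_def, dist_comm]
    rw [this]
    exact isClosed_biInter fun _ _ => isClosed_closedBall
  rw [hclosed.frontier_eq]
  refine Subset.antisymm ?_ ?_
  · rintro x ⟨hx, hxint⟩
    obtain ⟨y, hy, hymax⟩ := hKcomp.exists_isMaxOn (hKint.mono interior_subset)
      (continuous_id.dist continuous_const : Continuous fun y => dist y x).continuousOn
    have hyr : dist y x = r := by
      refine le_antisymm (hx hy) (not_lt.1 fun hlt => hxint ?_)
      refine mem_interior.2 ⟨ball x (r - dist y x), fun z hz w hw => ?_, isOpen_ball,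
        mem_ball_self (sub_pos.2 hlt)⟩
      have h1 : dist w x ≤ dist y x := hymax hw
      have h2 := mem_ball'.1 hz
      have h3 := dist_triangle w x z
      rw [mem_closedBall]
      linarith
    have hxy : ‖r⁻¹ • (x - y)‖ = 1 := by
      rw [norm_smul, ← dist_eq_norm, dist_comm, hyr, norm_inv, Real.norm_of_nonneg hr0.le,
        inv_mul_cancel₀ hr0.ne']
    obtain ⟨φ, hφ⟩ := exists_unitNormal_eq hxy
    have hx' : x = y + r • unitNormal φ := by
      rw [← hφ, smul_inv_smul₀ hr0.ne', add_sub_cancel]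
    refine ⟨φ, ?_⟩
    have hball := mem_closedBall.1 (hx (hmem φ))
    have h1 := abs_le.1 (abs_real_inner_le_norm (c φ - x) (unitNormal φ))
    rw [norm_unitNormal, mul_one, ← dist_eq_norm, inner_sub_left, hx', inner_add_left,
      real_inner_smul_left, hnn, ← hx'] at h1
    have hyc : y = c φ := eq_of_inner_le_of_frontier_eq_range hKc hKconv hKint hρ hc hrange hy
      (by linarith [h1.1])
    rw [hx', hyc]
  · rintro _ ⟨θ, rfl⟩
    refine ⟨fun y hy => ?_, notMem_interior_of_forall_inner_le (v := -unitNormal θ) ?_ ?_⟩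
    · rw [mem_closedBall, dist_eq_norm]
      set x := c θ + r • unitNormal θ with hx
      by_cases hyx : y - x = 0
      · rw [hyx, norm_zero]
        exact hr0.le
      have hunit : ‖-(‖y - x‖⁻¹ • (y - x))‖ = 1 := by
        rw [norm_neg, norm_smul, norm_inv, norm_norm, inv_mul_cancel₀ (norm_ne_zero_iff.2 hyx)]
      obtain ⟨φ, hφ⟩ := exists_unitNormal_eq hunit
      have h1 := inner_le_inner_of_periodic (fun θ => sub_pos.2 (hr θ)) hd hdper θ φ
      have h2 := inner_le_inner_of_frontier_eq_range hKc hKconv hKint hρ hc hrange hy φ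
      have h3 : ⟪y - x, unitNormal φ⟫ = -‖y - x‖ := by
        rw [← hφ, inner_neg_right, real_inner_smul_right, real_inner_self_eq_norm_sq, sq,
          inv_mul_cancel_left₀ (norm_ne_zero_iff.2 hyx)]
      simp only [← hx] at h1
      rw [inner_neg_left, inner_neg_left, inner_add_left, real_inner_smul_left, hnn] at h1
      rw [inner_sub_left] at h3
      linarith
    · exact neg_ne_zero.2 (norm_ne_zero_iff.1 (by simp [norm_unitNormal]))
    · intro x hx
      have hball := mem_closedBall'.1 (hx (hmem θ))
      have h1 := abs_le.1 (abs_real_inner_le_norm (x - c θ) (unitNormal θ))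
      rw [norm_unitNormal, mul_one, ← dist_eq_norm, inner_sub_left] at h1
      rw [inner_neg_right, inner_neg_right, inner_add_left, real_inner_smul_left, hnn]
      linarith [h1.2]

end Boundary

theorem hausdorffMeasure_range_of_periodic {q : ℝ → EuclideanSpace ℝ (Fin 2)} {w : ℝ → ℝ}
    (hwc : Continuous w) (hw : ∀ θ, 0 < w θ) (hq : ∀ θ, HasDerivAt q (w θ • unitVec θ) θ)
    (hper : Function.Periodic q (2 * Real.pi)) :
    (μH[1] (range q)).toReal = ∫ θ in (0 : ℝ)..2 * Real.pi, w θ := by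
  have hrange : range q = q '' Ico 0 (2 * Real.pi) := by
    refine Subset.antisymm ?_ (image_subset_range _ _)
    rintro _ ⟨θ, rfl⟩
    obtain ⟨φ, hφ, h⟩ := hper.exists_mem_Ico₀ Real.two_pi_pos θ
    exact ⟨φ, hφ, h.symm⟩
  rw [hrange, hausdorffMeasure_image_Ico_eq_integral Real.two_pi_pos.le hq
    (hwc.smul continuous_unitVec) (injOn_Ico_of_periodic hw hq hper)]
  simp only [norm_smul, norm_unitVec, mul_one, Real.norm_of_nonneg (hw _).le]

/-- For a planar convex body `K` with `C²` boundary of curvature `κ ≥ κₘ > 0` and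
`r > 1/κₘ`, the perimeters (one-dimensional Hausdorff measures of the boundaries)
satisfy `Per(K) + Per(K^{*,r}) = 2πr`, where `K^{*,r} = {x : K ⊆ rB² + x}`. -/
theorem perimeter_of_r_dual
    (K : Set (EuclideanSpace ℝ (Fin 2)))
    (hKcomp : IsCompact K) (hKconv : Convex ℝ K) (hKint : (interior K).Nonempty)
    (γ : ℝ → EuclideanSpace ℝ (Fin 2)) (hγ : ContDiff ℝ 2 γ)
    (hγspeed : ∀ s, ‖deriv γ s‖ = 1)
    (hγrange : frontier K = Set.range γ)
    (κ : ℝ → ℝ)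
    (hκdef : ∀ s, κ s =
      deriv γ s 0 * deriv (deriv γ) s 1 - deriv γ s 1 * deriv (deriv γ) s 0)
    (κm : ℝ) (hκm : 0 < κm) (hκ : ∀ s, κm ≤ κ s)
    (r : ℝ) (hr : 1 / κm < r) :
    (μH[1] (frontier K)).toReal +
      (μH[1] (frontier {x | K ⊆ closedBall x r})).toReal = 2 * Real.pi * r := by
  obtain ⟨c, ρ, hρc, hρ, hρle, hc, hcγ⟩ :=
    exists_tangent_angle_parametrization hγ hγspeed hκdef hκm hκ
  have hrange : frontier K = range c := hγrange.trans hcγ.symm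
  have hρr : ∀ θ, ρ θ < r := fun θ => (hρle θ).trans_lt hr
  have hper := periodic_of_frontier_eq_range hKcomp.isClosed hKconv hKint hρ hc hrange
  have hneg : μH[1] (range fun θ => c θ + r • unitNormal θ) =
      μH[1] (range fun θ => -(c θ + r • unitNormal θ)) := by
    rw [← (LinearIsometryEquiv.neg ℝ : EuclideanSpace ℝ (Fin 2) ≃ₗᵢ[ℝ] _).isometry
      |>.hausdorffMeasure_image (Or.inl zero_le_one), ← range_comp]
    rfl
  rw [frontier_setOf_subset_closedBall hKcomp hKconv hKint hρ hc hrange hρr, hneg, hrange,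
    hausdorffMeasure_range_of_periodic hρc hρ hc hper,
    hausdorffMeasure_range_of_periodic (w := fun θ => r - ρ θ) (continuous_const.sub hρc)
      (fun θ => sub_pos.2 (hρr θ)) (fun θ => hasDerivAt_neg_add_smul_unitNormal (hc θ) r)
      (periodic_neg_add_smul_unitNormal hper r),
    intervalIntegral.integral_sub (by simp) (hρc.intervalIntegrable _ _)]
  simp
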